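/- arXiv:1803.03418 — 2 statements merged into one kernel-verified Lean document; each statement's English description precedes it below -/
import Mathlib

section
/- Let S be an admissible class of spans in a category C and consider morphisms f : A ⟶ B, g : C ⟶ B, h : C ⟶ D, k : E ⟶ D such that the S-relative pullbacks A □_B C of (f, g), (A □_B C) □_D E of (h ∘ p_C, k), C □_D E of (h, k), and A □_B (C □_D E) of (f, g ∘ p_C) all exist. Then there is an isomorphism l : (A □_B C) □_D E ⟶ A □_B (C □_D E) compatible with the projections to A, C and E: p_A ∘ l = p_A ∘ p_{A □_B C}, p_C ∘ p_{C □_D E} ∘ l = p_C ∘ p_{A □_B C}, and p_E ∘ p_{C □_D E} ∘ l = p_E. -/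
open CategoryTheory

/-- A class of spans `(f : A ⟶ X, g : A ⟶ Y)` in a category is admissible if it is
closed under post-composition of both legs (POST) and under pre-composition with a
common morphism (PRE). -/
def IsAdmissibleClass {C : Type*} [Category C]
    (S : ∀ {A X Y : C}, (A ⟶ X) → (A ⟶ Y) → Prop) : Prop :=
  (∀ {A X Y X' Y' : C} (f : A ⟶ X) (g : A ⟶ Y) (f' : X ⟶ X') (g' : Y ⟶ Y'),
      S f g → S (f ≫ f') (g ≫ g')) ∧
  (∀ {A X Y B : C} (f : A ⟶ X) (g : A ⟶ Y) (h : B ⟶ A),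
      S f g → S (h ≫ f) (h ≫ g))

/-- `(pA : P ⟶ A, pC : P ⟶ C')` is an `S`-relative pullback of the cospan
`(a : A ⟶ B, c : C' ⟶ B)`. -/
structure IsRelPullback {C : Type*} [Category C]
    (S : ∀ {A X Y : C}, (A ⟶ X) → (A ⟶ Y) → Prop)
    {A B C' P : C} (a : A ⟶ B) (c : C' ⟶ B) (pA : P ⟶ A) (pC : P ⟶ C') : Prop where
  mem : S pA pC
  comm : pA ≫ a = pC ≫ c
  universal : ∀ {X : C} (f : X ⟶ A) (g : X ⟶ C'), S f g → f ≫ a = g ≫ c →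
    ∃! h : X ⟶ P, h ≫ pA = f ∧ h ≫ pC = g
  refl_left : ∀ {D E : C} (f : D ⟶ P) (g : D ⟶ E),
    S (f ≫ pA) g → S (f ≫ pC) g → S f g
  refl_right : ∀ {D E : C} (f : D ⟶ P) (g : D ⟶ E),
    S g (f ≫ pA) → S g (f ≫ pC) → S g f

/-- The projections of a relative pullback are jointly monic. -/
theorem IsRelPullback.hom_ext {C : Type*} [Category C]
    {S : ∀ {A X Y : C}, (A ⟶ X) → (A ⟶ Y) → Prop} (hS : IsAdmissibleClass S)
    {A B C' P X : C} {a : A ⟶ B} {c : C' ⟶ B} {pA : P ⟶ A} {pC : P ⟶ C'}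
    (hP : IsRelPullback S a c pA pC) {u v : X ⟶ P}
    (hA : u ≫ pA = v ≫ pA) (hC : u ≫ pC = v ≫ pC) : u = v :=
  (hP.universal (v ≫ pA) (v ≫ pC) (hS.2 _ _ v hP.mem) (by simp [hP.comm])).unique
    ⟨hA, hC⟩ ⟨rfl, rfl⟩

/-- A class of spans closed under (POST) is closed under post-composition of its left leg. -/
theorem IsAdmissibleClass.comp_left {C : Type*} [Category C]
    {S : ∀ {A X Y : C}, (A ⟶ X) → (A ⟶ Y) → Prop} (hS : IsAdmissibleClass S)
    {A X Y X' : C} {f : A ⟶ X} {g : A ⟶ Y} (hfg : S f g) (f' : X ⟶ X') :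
    S (f ≫ f') g := by
  simpa using hS.1 f g f' (𝟙 Y) hfg

/-- A class of spans closed under (POST) is closed under post-composition of its right leg. -/
theorem IsAdmissibleClass.comp_right {C : Type*} [Category C]
    {S : ∀ {A X Y : C}, (A ⟶ X) → (A ⟶ Y) → Prop} (hS : IsAdmissibleClass S)
    {A X Y Y' : C} {f : A ⟶ X} {g : A ⟶ Y} (hfg : S f g) (g' : Y ⟶ Y') :
    S f (g ≫ g') := by
  simpa using hS.1 f g (𝟙 X) g' hfg

/-- Associativity of `S`-relative pullbacks: given
`f : A ⟶ B`, `g : C ⟶ B`, `h : C ⟶ D`, `k : E ⟶ D` such that the relative pullbacks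
`A □_B C`, `(A □_B C) □_D E`, `C □_D E` and `A □_B (C □_D E)` all exist, there is an
isomorphism `l : (A □_B C) □_D E ⟶ A □_B (C □_D E)` compatible with the projections
to `A`, `C` and `E`. -/
theorem relPullback_assoc {𝒞 : Type*} [Category 𝒞]
    (S : ∀ {A X Y : 𝒞}, (A ⟶ X) → (A ⟶ Y) → Prop) (hS : IsAdmissibleClass S)
    {A B C D E : 𝒞} (f : A ⟶ B) (g : C ⟶ B) (h : C ⟶ D) (k : E ⟶ D)
    {P₁ : 𝒞} (p₁A : P₁ ⟶ A) (p₁C : P₁ ⟶ C) (hP₁ : IsRelPullback S f g p₁A p₁C)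
    {P₂ : 𝒞} (p₂ : P₂ ⟶ P₁) (q₂ : P₂ ⟶ E) (hP₂ : IsRelPullback S (p₁C ≫ h) k p₂ q₂)
    {P₃ : 𝒞} (p₃C : P₃ ⟶ C) (p₃E : P₃ ⟶ E) (hP₃ : IsRelPullback S h k p₃C p₃E)
    {P₄ : 𝒞} (p₄A : P₄ ⟶ A) (p₄ : P₄ ⟶ P₃)
    (hP₄ : IsRelPullback S f (p₃C ≫ g) p₄A p₄) :
    ∃ l : P₂ ⟶ P₄, IsIso l ∧
      l ≫ p₄A = p₂ ≫ p₁A ∧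
      l ≫ p₄ ≫ p₃C = p₂ ≫ p₁C ∧
      l ≫ p₄ ≫ p₃E = q₂ := by
  obtain ⟨u, ⟨huC, huE⟩, -⟩ := hP₃.universal (p₂ ≫ p₁C) q₂ (hS.comp_left hP₂.mem p₁C)
    (by simpa using hP₂.comm)
  have hu : S (p₂ ≫ p₁A) u := hP₃.refl_right u (p₂ ≫ p₁A)
    (by rw [huC]; exact hS.2 _ _ p₂ hP₁.mem)
    (by rw [huE]; exact hS.comp_left hP₂.mem p₁A)
  obtain ⟨l, ⟨hlA, hl⟩, -⟩ := hP₄.universal (p₂ ≫ p₁A) u hu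
    (by rw [← Category.assoc u, huC, Category.assoc, Category.assoc, hP₁.comm])
  obtain ⟨v, ⟨hvA, hvC⟩, -⟩ := hP₁.universal p₄A (p₄ ≫ p₃C) (hS.comp_right hP₄.mem p₃C)
    (by simpa using hP₄.comm)
  have hv : S v (p₄ ≫ p₃E) := hP₁.refl_left v (p₄ ≫ p₃E)
    (by rw [hvA]; exact hS.comp_right hP₄.mem p₃E)
    (by rw [hvC]; exact hS.2 _ _ p₄ hP₃.mem)
  obtain ⟨m, ⟨hm₁, hmE⟩, -⟩ := hP₂.universal v (p₄ ≫ p₃E) hv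
    (by rw [← Category.assoc v, hvC, Category.assoc, Category.assoc, hP₃.comm])
  have hlC : l ≫ p₄ ≫ p₃C = p₂ ≫ p₁C := by rw [← Category.assoc, hl, huC]
  have hlE : l ≫ p₄ ≫ p₃E = q₂ := by rw [← Category.assoc, hl, huE]
  refine ⟨l, ⟨m, ?_, ?_⟩, hlA, hlC, hlE⟩
  · apply hP₂.hom_ext hS
    · apply hP₁.hom_ext hS <;> simp [hm₁, hvA, hvC, hlA, hlC]
    · simp [hmE, hlE]
  · apply hP₄.hom_ext hS
    · simp [hlA, reassoc_of% hm₁, hvA]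
    · apply hP₃.hom_ext hS
      · simp [hlC, reassoc_of% hm₁, hvC]
      · simp [hlE, hmE]
end

section
/- Let S be an admissible class of spans in a category C such that every cospan with legs in S admits an S-relative pullback (i.e. whenever (1_A, a : A ⟶ B) ∈ S and (c : C ⟶ B, 1_C) ∈ S, an S-relative pullback of (a, c) exists). Consider morphisms f : A ⟶ B, g : C ⟶ B, h : C ⟶ D, k : E ⟶ D such that the spans (1_A, f), (g, 1_C), (1_C, h), (k, 1_E) all belong to S. Then all four S-relative pullbacks A □_B C of (f, g), (A □_B C) □_D E of (h ∘ p_C, k), C □_D E of (h, k), and A □_B (C □_D E) of (f, g ∘ p_C) exist. -/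
open CategoryTheory

/-- If every cospan with legs in `S` admits an `S`-relative pullback,
then for morphisms `f : A ⟶ B`, `g : C ⟶ B`, `h : C ⟶ D`, `k : E ⟶ D` with
`(1_A, f), (g, 1_C), (1_C, h), (k, 1_E) ∈ S`, all four iterated `S`-relative pullbacks
`A □_B C`, `(A □_B C) □_D E`, `C □_D E` and `A □_B (C □_D E)` exist. -/
theorem iterated_relPullbacks_exist {𝒞 : Type*} [Category 𝒞]
    (S : ∀ {A X Y : 𝒞}, (A ⟶ X) → (A ⟶ Y) → Prop) (hS : IsAdmissibleClass S)
    (hex : ∀ {A B C : 𝒞} (a : A ⟶ B) (c : C ⟶ B), S (𝟙 A) a → S c (𝟙 C) →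
      ∃ (P : 𝒞) (pA : P ⟶ A) (pC : P ⟶ C), IsRelPullback S a c pA pC)
    {A B C D E : 𝒞} (f : A ⟶ B) (g : C ⟶ B) (h : C ⟶ D) (k : E ⟶ D)
    (h₁ : S (𝟙 A) f) (h₂ : S g (𝟙 C)) (h₃ : S (𝟙 C) h) (h₄ : S k (𝟙 E)) :
    (∃ (P₁ : 𝒞) (p₁A : P₁ ⟶ A) (p₁C : P₁ ⟶ C), IsRelPullback S f g p₁A p₁C) ∧
    (∀ {P₁ : 𝒞} (p₁A : P₁ ⟶ A) (p₁C : P₁ ⟶ C), IsRelPullback S f g p₁A p₁C →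
      ∃ (P₂ : 𝒞) (p₂ : P₂ ⟶ P₁) (q₂ : P₂ ⟶ E), IsRelPullback S (p₁C ≫ h) k p₂ q₂) ∧
    (∃ (P₃ : 𝒞) (p₃C : P₃ ⟶ C) (p₃E : P₃ ⟶ E), IsRelPullback S h k p₃C p₃E) ∧
    (∀ {P₃ : 𝒞} (p₃C : P₃ ⟶ C) (p₃E : P₃ ⟶ E), IsRelPullback S h k p₃C p₃E →
      ∃ (P₄ : 𝒞) (p₄A : P₄ ⟶ A) (p₄ : P₄ ⟶ P₃),
        IsRelPullback S f (p₃C ≫ g) p₄A p₄) := by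
  obtain ⟨post, pre⟩ := hS
  refine ⟨hex f g h₁ h₂, fun p₁A p₁C hP => ?_, hex h k h₃ h₄, fun p₃C p₃E hP => ?_⟩
  · refine hex _ _ (hP.refl_left _ _ ?_ ?_) h₄
    · simpa using post _ _ (𝟙 A) h hP.mem
    · simpa using pre _ _ p₁C h₃
  · refine hex _ _ h₁ (hP.refl_right _ _ ?_ ?_)
    · simpa using pre _ _ p₃C h₂
    · simpa using post _ _ g (𝟙 E) hP.mem
end
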